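/- Let T > 0, let ε₀, C > 0 and let a : ℝ × ℝ → ℝ be continuously differentiable with ε₀ ≤ a(ξ, ỹ) ≤ C(1 + |ξ|). Let h : [0,T] × ℝ → ℝ, B : [0,T] → ℝ and g : [0,T] → ℝ be continuous, and let y : [0,T] → ℝ be continuously differentiable with y'(t) = B(t) − (1/2) a(y(t), ỹ(t)) (∂a/∂y)(y(t), ỹ(t)) + a(y(t), ỹ(t)) g(t), where ỹ(t) = ∫₀^t h(u, y(u)) du. Define S(y, ỹ) = ∫₀^y dξ / a(ξ, ỹ) and x(t) = S(y(t), ỹ(t)). Then x is continuously differentiable on [0,T] and x'(t) = B(t)/a(y(t), ỹ(t)) + (∂S/∂ỹ)(y(t), ỹ(t)) · h(t, y(t)) − (1/2)(∂a/∂y)(y(t), ỹ(t)) + g(t), where ∂S/∂ỹ(y, ỹ) = − ∫₀^y (∂a/∂ỹ)(ξ, ỹ)/a(ξ, ỹ)² dξ. -/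

import Mathlib

open MeasureTheory intervalIntegral Set

theorem lamperti_aux_hasDerivAt
    (a : ℝ × ℝ → ℝ) (ha : ContDiff ℝ 1 a) (hpos : ∀ p, 0 < a p) (ξ w : ℝ) :
    HasDerivAt (fun w : ℝ => (a (ξ, w))⁻¹)
      (-(fderiv ℝ a (ξ, w) (0, 1) / (a (ξ, w)) ^ 2)) w := by
  have h1 : HasDerivAt (fun w : ℝ => a (ξ, w)) (fderiv ℝ a (ξ, w) (0, 1)) w := by
    have h2 := (ha.differentiable one_ne_zero (ξ, w)).hasFDerivAt
    exact h2.comp_hasDerivAt w ((hasDerivAt_const w ξ).prodMk (hasDerivAt_id w))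
  have h3 := h1.fun_inv (hpos _).ne'
  rwa [neg_div] at h3

theorem lamperti_aux_deriv
    (a : ℝ × ℝ → ℝ) (ha : ContDiff ℝ 1 a) (ξ w : ℝ) :
    deriv (fun w : ℝ => a (ξ, w)) w = fderiv ℝ a (ξ, w) (0, 1) := by
  have h2 := (ha.differentiable one_ne_zero (ξ, w)).hasFDerivAt
  exact (h2.comp_hasDerivAt w ((hasDerivAt_const w ξ).prodMk (hasDerivAt_id w))).deriv

/-- The partial derivative of the Lamperti transform in the memory variable. -/
theorem lamperti_aux_partial
    (a : ℝ × ℝ → ℝ) (ha : ContDiff ℝ 1 a) (hpos : ∀ p, 0 < a p) (p q : ℝ) :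
    HasDerivAt (fun w : ℝ => ∫ ξ in (0:ℝ)..p, (a (ξ, w))⁻¹)
      (∫ ξ in (0:ℝ)..p, -(fderiv ℝ a (ξ, q) (0, 1) / (a (ξ, q)) ^ 2)) q := by
  have hac : Continuous a := ha.continuous
  have hF : Continuous (fun z : ℝ × ℝ => -(fderiv ℝ a z (0, 1) / (a z) ^ 2)) :=
    (((ha.continuous_fderiv one_ne_zero).clm_apply continuous_const).div (hac.pow 2)
      (fun z => pow_ne_zero 2 (hpos z).ne')).neg
  have hI : Continuous (fun z : ℝ × ℝ => (a z)⁻¹) := hac.inv₀ (fun z => (hpos z).ne')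
  obtain ⟨M, hM⟩ := ((isCompact_uIcc (a := (0:ℝ)) (b := p)).prod
    (isCompact_closedBall q 1)).exists_bound_of_continuousOn hF.continuousOn
  refine (intervalIntegral.hasDerivAt_integral_of_dominated_loc_of_deriv_le
    (F := fun w ξ => (a (ξ, w))⁻¹)
    (F' := fun w ξ => -(fderiv ℝ a (ξ, w) (0, 1) / (a (ξ, w)) ^ 2))
    (bound := fun _ => M) (Metric.closedBall_mem_nhds q one_pos) ?_ ?_ ?_ ?_ ?_ ?_).2
  · exact Filter.Eventually.of_forall fun w =>
      (hI.comp (by fun_prop : Continuous fun ξ : ℝ => (ξ, w))).aestronglyMeasurable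
  · exact (hI.comp (by fun_prop : Continuous fun ξ : ℝ => (ξ, q))).intervalIntegrable _ _
  · exact (hF.comp (by fun_prop : Continuous fun ξ : ℝ => (ξ, q))).aestronglyMeasurable
  · exact Filter.Eventually.of_forall fun ξ hξ w hw =>
      hM (ξ, w) ⟨uIoc_subset_uIcc hξ, hw⟩
  · exact intervalIntegrable_const
  · exact Filter.Eventually.of_forall fun ξ _ w _ => lamperti_aux_hasDerivAt a ha hpos ξ w

/-- The total derivative of the Lamperti transform. -/
theorem lamperti_aux_fderiv
    (a : ℝ × ℝ → ℝ) (ha : ContDiff ℝ 1 a) (hpos : ∀ p, 0 < a p) (p q : ℝ) :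
    HasFDerivAt (fun z : ℝ × ℝ => ∫ ξ in (0:ℝ)..z.1, (a (ξ, z.2))⁻¹)
      ((ContinuousLinearMap.toSpanSingleton ℝ ((a (p, q))⁻¹)).coprod
        (ContinuousLinearMap.toSpanSingleton ℝ
          (∫ ξ in (0:ℝ)..p, -(fderiv ℝ a (ξ, q) (0, 1) / (a (ξ, q)) ^ 2)))) (p, q) := by
  have hac : Continuous a := ha.continuous
  have hF : Continuous (fun z : ℝ × ℝ => -(fderiv ℝ a z (0, 1) / (a z) ^ 2)) :=
    (((ha.continuous_fderiv one_ne_zero).clm_apply continuous_const).div (hac.pow 2)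
      (fun z => pow_ne_zero 2 (hpos z).ne')).neg
  have hI : Continuous (fun z : ℝ × ℝ => (a z)⁻¹) := hac.inv₀ (fun z => (hpos z).ne')
  have hT : Continuous (fun c : ℝ => ContinuousLinearMap.toSpanSingleton ℝ c) :=
    (ContinuousLinearMap.toSpanSingletonCLE (𝕜 := ℝ) (E := ℝ)).continuous
  have hG : Continuous (fun z : ℝ × ℝ =>
      ∫ ξ in (0:ℝ)..z.1, -(fderiv ℝ a (ξ, z.2) (0, 1) / (a (ξ, z.2)) ^ 2)) :=
    intervalIntegral.continuous_parametric_intervalIntegral_of_continuous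
      (f := fun (z : ℝ × ℝ) ξ => -(fderiv ℝ a (ξ, z.2) (0, 1) / (a (ξ, z.2)) ^ 2))
      (hF.comp (by fun_prop : Continuous fun v : (ℝ × ℝ) × ℝ => (v.2, v.1.2))) continuous_fst
  refine (hasStrictFDerivAt_uncurry_coprod (𝕜 := ℝ) (u := (p, q))
    (f := fun p q => ∫ ξ in (0:ℝ)..p, (a (ξ, q))⁻¹)
    (f₁ := fun p q => ContinuousLinearMap.toSpanSingleton ℝ ((a (p, q))⁻¹))
    (f₂ := fun p q => ContinuousLinearMap.toSpanSingleton ℝ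
          (∫ ξ in (0:ℝ)..p, -(fderiv ℝ a (ξ, q) (0, 1) / (a (ξ, q)) ^ 2)))
    ?_ ?_ ?_ ?_).hasFDerivAt
  · refine Filter.Eventually.of_forall fun v => ?_
    have hc : Continuous fun ξ : ℝ => (a (ξ, v.2))⁻¹ :=
      hI.comp (by fun_prop : Continuous fun ξ : ℝ => (ξ, v.2))
    exact (hc.integral_hasStrictDerivAt 0 v.1).hasDerivAt.hasFDerivAt
  · exact Filter.Eventually.of_forall fun v =>
      (lamperti_aux_partial a ha hpos v.1 v.2).hasFDerivAt
  · exact (hT.comp hI).continuousAt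
  · exact (hT.comp hG).continuousAt

theorem lamperti_chain_rule_codeword
    (T ε₀ C : ℝ) (hT : 0 < T) (hε₀ : 0 < ε₀) (hC : 0 < C)
    (a : ℝ × ℝ → ℝ) (ha : ContDiff ℝ 1 a)
    (hlow : ∀ ξ ytil : ℝ, ε₀ ≤ a (ξ, ytil))
    (hup : ∀ ξ ytil : ℝ, a (ξ, ytil) ≤ C * (1 + |ξ|))
    (h : ℝ → ℝ → ℝ) (hh : ContinuousOn (Function.uncurry h) (Set.Icc 0 T ×ˢ Set.univ))
    (B g : ℝ → ℝ) (hB : ContinuousOn B (Set.Icc 0 T)) (hg : ContinuousOn g (Set.Icc 0 T))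
    (y ytil x : ℝ → ℝ)
    (hytil : ∀ t : ℝ, ytil t = ∫ u in (0:ℝ)..t, h u (y u))
    (hy : ∀ t ∈ Set.Icc (0:ℝ) T,
      HasDerivWithinAt y
        (B t - (1/2) * a (y t, ytil t) * deriv (fun w : ℝ => a (w, ytil t)) (y t)
          + a (y t, ytil t) * g t) (Set.Icc 0 T) t)
    (hx : ∀ t : ℝ, x t = ∫ ξ in (0:ℝ)..(y t), (a (ξ, ytil t))⁻¹) :
    ∀ t ∈ Set.Icc (0:ℝ) T,
      HasDerivWithinAt x
        (B t / a (y t, ytil t)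
          + (-(∫ ξ in (0:ℝ)..(y t), deriv (fun w : ℝ => a (ξ, w)) (ytil t) / (a (ξ, ytil t))^2))
              * h t (y t)
          - (1/2) * deriv (fun w : ℝ => a (w, ytil t)) (y t)
          + g t) (Set.Icc 0 T) t := by
  intro t ht
  have hpos : ∀ p, 0 < a p := fun p => hε₀.trans_le (hlow p.1 p.2)
  have hyc : ContinuousOn y (Set.Icc 0 T) := fun s hs => (hy s hs).continuousWithinAt
  have hhc : ContinuousOn (fun u => h u (y u)) (Set.Icc 0 T) :=
    hh.comp (f := fun u => (u, y u)) (continuousOn_id.prodMk hyc) (fun u hu => ⟨hu, mem_univ _⟩)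
  have hyt : HasDerivWithinAt ytil (h t (y t)) (Set.Icc 0 T) t := by
    have hfun : ytil = fun t => ∫ u in (0:ℝ)..t, h u (y u) := funext hytil
    rw [hfun]
    haveI : Fact (t ∈ Set.Icc 0 T) := ⟨ht⟩
    refine intervalIntegral.integral_hasDerivWithinAt_right (s := Set.Icc 0 T) (t := Set.Icc 0 T)
      ?_ ?_ (hhc t ht)
    · apply ContinuousOn.intervalIntegrable
      rw [uIcc_of_le ht.1]
      exact hhc.mono (Icc_subset_Icc_right ht.2)
    · exact hhc.stronglyMeasurableAtFilter_nhdsWithin measurableSet_Icc t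
  have hfun : x = fun t => ∫ ξ in (0:ℝ)..(y t), (a (ξ, ytil t))⁻¹ := funext hx
  have key := (lamperti_aux_fderiv a ha hpos (y t) (ytil t)).comp_hasDerivWithinAt t
    (f := fun t => (y t, ytil t)) ((hy t ht).prodMk hyt)
  rw [hfun]
  refine HasDerivWithinAt.congr_deriv (f := fun t => ∫ ξ in (0:ℝ)..(y t), (a (ξ, ytil t))⁻¹)
    key ?_
  have hne := (hpos (y t, ytil t)).ne'
  simp only [lamperti_aux_deriv a ha, intervalIntegral.integral_neg,
    ContinuousLinearMap.coprod_apply, ContinuousLinearMap.toSpanSingleton_apply, smul_eq_mul]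
  field_simp
  ring
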